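/- Fix d ≥ 2. Let (a_n)_{n≥1} be positive reals with a_n → ∞, define x_1 = a_1 and x_{n+1} = x_n + a_n + a_{n+1}, let e_1 be the first standard basis vector, and set ω_n = Q_{a_n}(x_n e_1), Ω = ⋃_{n≥1} ω_n. Let (δ_n)_{n≥1} satisfy 0 < δ_n < min(a_n, a_{n+1}) for every n, and define the windowed tower Ω' = Ω ∪ ⋃_{n≥1} Q_{δ_n}((x_n + a_n) e_1). Then Ω' is an open, connected, quasi-conical subset of ℝ^d. -/

import Mathlib

/-- The open cube of half-width `a` centred at `c`:
`Q_a(c) = {x : |xᵢ - cᵢ| < a for all i}`. -/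
def openCube {d : ℕ} (a : ℝ) (c : EuclideanSpace ℝ (Fin d)) :
    Set (EuclideanSpace ℝ (Fin d)) :=
  {x | ∀ i : Fin d, |x i - c i| < a}

/-- An open set is quasi-conical if it contains arbitrarily large balls. -/
def QuasiConical {d : ℕ} (Ω : Set (EuclideanSpace ℝ (Fin d))) : Prop :=
  ∀ r > 0, ∃ y : EuclideanSpace ℝ (Fin d), Metric.ball y r ⊆ Ω

theorem isOpen_openCube {d : ℕ} (a : ℝ) (c : EuclideanSpace ℝ (Fin d)) :
    IsOpen (openCube a c) := by
  have h : openCube a c = ⋂ i : Fin d, {x | |x i - c i| < a} := by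
    ext x
    simp [openCube]
  rw [h]
  exact isOpen_iInter_of_finite fun i => isOpen_lt (by fun_prop) continuous_const

theorem convex_openCube {d : ℕ} (a : ℝ) (c : EuclideanSpace ℝ (Fin d)) :
    Convex ℝ (openCube a c) := by
  intro x hx y hy s t hs ht hst i
  have h := convex_ball (c i) a (hx i) (hy i) hs ht hst
  simpa [Real.dist_eq] using h

theorem ball_subset_openCube {d : ℕ} (a : ℝ) (c : EuclideanSpace ℝ (Fin d)) :
    Metric.ball c a ⊆ openCube a c := by
  intro x hx i
  rw [Metric.mem_ball, dist_eq_norm] at hx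
  exact (PiLp.norm_apply_le (x - c) i).trans_lt hx

theorem single_mem_openCube {d : ℕ} {a s u : ℝ} (i : Fin d) (h : |u - s| < a) :
    EuclideanSpace.single i u ∈ openCube a (EuclideanSpace.single i s) := by
  intro j
  by_cases hj : j = i
  · simpa [hj] using h
  · simpa [hj] using (abs_nonneg _).trans_lt h

/-- Two cubes centred on a common axis meet if their centres are closer than the sum of their
half-widths. -/
theorem openCube_single_inter_nonempty {d : ℕ} {a b s t : ℝ} (i : Fin d) (ha : 0 < a)
    (hb : 0 < b) (h : |t - s| < a + b) :
    (openCube a (EuclideanSpace.single i s) ∩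
      openCube b (EuclideanSpace.single i t)).Nonempty := by
  have hab : 0 < a + b := add_pos ha hb
  refine ⟨EuclideanSpace.single i ((b * s + a * t) / (a + b)),
    single_mem_openCube i ?_, single_mem_openCube i ?_⟩
  · have e : (b * s + a * t) / (a + b) - s = a * (t - s) / (a + b) := by
      field_simp
      ring
    rw [e, abs_div, abs_mul, abs_of_pos ha, abs_of_pos hab, div_lt_iff₀ hab]
    exact mul_lt_mul_of_pos_left h ha
  · have e : (b * s + a * t) / (a + b) - t = -(b * (t - s) / (a + b)) := by
      field_simp
      ring
    rw [e, abs_neg, abs_div, abs_mul, abs_of_pos hb, abs_of_pos hab, div_lt_iff₀ hab]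
    exact mul_lt_mul_of_pos_left h hb

/-- The tower of cubes of growing size interconnected by small cubic windows is an open,
connected, quasi-conical set. -/
theorem windowed_tower_open_connected_quasiConical {d : ℕ} (hd : 2 ≤ d)
    (a : ℕ → ℝ) (ha : ∀ n, 1 ≤ n → 0 < a n)
    (ha' : Filter.Tendsto a Filter.atTop Filter.atTop)
    (x : ℕ → ℝ) (hx1 : x 1 = a 1)
    (hx : ∀ n, 1 ≤ n → x (n + 1) = x n + a n + a (n + 1))
    (ω : ℕ → Set (EuclideanSpace ℝ (Fin d)))
    (hω : ∀ n, ω n = openCube (a n) (EuclideanSpace.single (⟨0, by omega⟩ : Fin d) (x n)))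
    (Ω : Set (EuclideanSpace ℝ (Fin d))) (hΩ : Ω = ⋃ n ∈ {n : ℕ | 1 ≤ n}, ω n)
    (δ : ℕ → ℝ) (hδ0 : ∀ n, 1 ≤ n → 0 < δ n)
    (hδ : ∀ n, 1 ≤ n → δ n < min (a n) (a (n + 1)))
    (Ω' : Set (EuclideanSpace ℝ (Fin d)))
    (hΩ' : Ω' = Ω ∪ ⋃ n ∈ {n : ℕ | 1 ≤ n},
        openCube (δ n) (EuclideanSpace.single (⟨0, by omega⟩ : Fin d) (x n + a n))) :
    IsOpen Ω' ∧ IsConnected Ω' ∧ QuasiConical Ω' := by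
  subst hΩ' hΩ
  simp only [hω]
  set e : Fin d := ⟨0, by omega⟩
  have meet : ∀ n, 1 ≤ n → (openCube (a n) (EuclideanSpace.single e (x n)) ∩
      openCube (δ n) (EuclideanSpace.single e (x n + a n))).Nonempty := fun n hn =>
    openCube_single_inter_nonempty e (ha n hn) (hδ0 n hn) (by
      rw [add_sub_cancel_left, abs_of_pos (ha n hn)]
      linarith [hδ0 n hn])
  refine ⟨?_, ?_, ?_⟩
  · exact (isOpen_biUnion fun n _ => isOpen_openCube _ _).union
      (isOpen_biUnion fun n _ => isOpen_openCube _ _)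
  · simp only [← Set.iUnion_union_distrib]
    refine IsConnected.biUnion_of_chain ⟨1, le_refl 1⟩ Set.ordConnected_Ici ?_ ?_
    · intro n hn
      obtain ⟨p, hp, hp'⟩ := meet n hn
      exact ⟨⟨p, Or.inl hp⟩, (convex_openCube _ _).isPreconnected.union p hp hp'
        (convex_openCube _ _).isPreconnected⟩
    · intro n hn _
      have hn1 : 1 ≤ n + 1 := Nat.le_add_left 1 n
      refine (openCube_single_inter_nonempty e (hδ0 n hn) (ha (n + 1) hn1) ?_).mono
        (Set.inter_subset_inter Set.subset_union_right Set.subset_union_left)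
      rw [Nat.succ_eq_succ, Nat.succ_eq_add_one, hx n hn, add_sub_cancel_left,
        abs_of_pos (ha _ hn1)]
      linarith [hδ0 n hn]
  · intro r _
    obtain ⟨n, hn, hn1⟩ :=
      ((ha'.eventually_ge_atTop r).and (Filter.eventually_ge_atTop 1)).exists
    refine ⟨EuclideanSpace.single e (x n), fun y hy => Or.inl ?_⟩
    exact Set.mem_biUnion (show n ∈ {n : ℕ | 1 ≤ n} from hn1)
      (ball_subset_openCube _ _ (Metric.ball_subset_ball hn hy))
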